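/- Let p ∈ [1,∞) and c ≥ 1. Let ℓ̄ : ℝ → ℝ be one of: ℓ₃(x) = (|x−m₁|−m₂)₊ for some m₁ ∈ ℝ and m₂ ≥ 0, or ℓ₄(x) = |x−m| + b for some m ∈ ℝ and b > 0; and set ℓ(z,t) = c·ℓ̄(z−t). Define, for a distribution F on ℝⁿ with finite p-th moment and β ∈ ℝⁿ, 𝒱^F(β^⊤Z) = inf_{t∈ℝ} E^F[ℓ(β^⊤Z, t)^p]. Then for every Borel probability distribution F₀ on ℝⁿ with finite p-th moment, every ε ≥ 0, and every D ⊆ ℝⁿ: inf_{β∈D} sup_{F∈B_p(F₀,ε)} 𝒱^F(β^⊤Z) = inf_{β∈D} ( (𝒱^{F₀}(β^⊤Z))^{1/p} + cε‖β‖_* )^p. -/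

import Mathlib

open MeasureTheory Set
open scoped ENNReal NNReal

noncomputable section

abbrev Vec (n : ℕ) := Fin n → ℝ

/-- `β^⊤x` -/
def dotp {n : ℕ} (β x : Vec n) : ℝ := ∑ i, β i * x i

/-- `nrm` is a norm on `ℝⁿ`. -/
def IsNorm {n : ℕ} (nrm : Vec n → ℝ) : Prop :=
  (∀ x, nrm x = 0 ↔ x = 0) ∧
  (∀ (c : ℝ) (x : Vec n), nrm (c • x) = |c| * nrm x) ∧
  (∀ x y : Vec n, nrm (x + y) ≤ nrm x + nrm y)

/-- the dual norm `‖β‖_* = sup_{‖x‖ ≤ 1} β^⊤x`. -/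
def dualNorm {n : ℕ} (nrm : Vec n → ℝ) (β : Vec n) : ℝ :=
  sSup {r | ∃ x, nrm x ≤ 1 ∧ r = dotp β x}

/-- Couplings of two probability measures. -/
def Couplings {E : Type*} [MeasurableSpace E] (μ ν : Measure E) : Set (Measure (E × E)) :=
  {π | IsProbabilityMeasure π ∧ π.map Prod.fst = μ ∧ π.map Prod.snd = ν}

/-- The type-`p` Wasserstein distance (valued in `ℝ≥0∞`) associated with an
extended-real-valued cost; for `p = ∞` it is the infimum over couplings of the essential
supremum of the cost. -/
def WassersteinD {E : Type*} [MeasurableSpace E] (cost : E → E → ℝ≥0∞) (p : ℝ≥0∞)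
    (μ ν : Measure E) : ℝ≥0∞ :=
  if p = ∞ then ⨅ π ∈ Couplings μ ν, essSup (fun z : E × E => cost z.1 z.2) π
  else ⨅ π ∈ Couplings μ ν, (∫⁻ z, cost z.1 z.2 ^ p.toReal ∂π) ^ (1 / p.toReal)

/-- Finite `p`-th moment (with respect to a "norm-like" function `nrm`);
for `p = ∞` it means essential boundedness. -/
def HasMomentP {E : Type*} [MeasurableSpace E] (nrm : E → ℝ) (p : ℝ≥0∞) (μ : Measure E) : Prop :=
  if p = ∞ then essSup (fun x => ENNReal.ofReal (nrm x)) μ ≠ ∞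
  else ∫⁻ x, ENNReal.ofReal (nrm x) ^ p.toReal ∂μ ≠ ∞

/-- The type-`p` Wasserstein ball of probability distributions on `ℝⁿ` (norm `nrm`). -/
def WballVec {n : ℕ} (nrm : Vec n → ℝ) (p : ℝ≥0∞) (μ₀ : Measure (Vec n)) (ε : ℝ) :
    Set (Measure (Vec n)) :=
  {μ | IsProbabilityMeasure μ ∧ HasMomentP nrm p μ ∧
    WassersteinD (fun x y => ENNReal.ofReal (nrm (x - y))) p μ μ₀ ≤ ENNReal.ofReal ε}

/-- The type-`p` Wasserstein ball of probability distributions on `ℝ`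
(absolute-value norm). -/
def WballReal (p : ℝ≥0∞) (μ₀ : Measure ℝ) (ε : ℝ) : Set (Measure ℝ) :=
  {μ | IsProbabilityMeasure μ ∧ HasMomentP (fun x : ℝ => |x|) p μ ∧
    WassersteinD (fun x y : ℝ => ENNReal.ofReal |x - y|) p μ μ₀ ≤ ENNReal.ofReal ε}

/-- The metric on `Ξ = {-1,1} × ℝⁿ`:
`d((y₁,x₁),(y₂,x₂)) = ‖x₁ - x₂‖` if `y₁ = y₂`, and `+∞` otherwise. -/
def xiCost {n : ℕ} (nrm : Vec n → ℝ) (z₁ z₂ : ℝ × Vec n) : ℝ≥0∞ :=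
  if z₁.1 = z₂.1 then ENNReal.ofReal (nrm (z₁.2 - z₂.2)) else ∞

/-- A measure on `ℝ × ℝⁿ` is concentrated on `Ξ = {-1,1} × ℝⁿ`. -/
def OnXi {n : ℕ} (μ : Measure (ℝ × Vec n)) : Prop :=
  μ {z | z.1 = 1 ∨ z.1 = -1} = 1

/-- The type-`p` Wasserstein ball `B̄_p(F₀,ε)` of probability distributions on
`Ξ = {-1,1} × ℝⁿ`. -/
def WballXi {n : ℕ} (nrm : Vec n → ℝ) (p : ℝ≥0∞) (μ₀ : Measure (ℝ × Vec n)) (ε : ℝ) :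
    Set (Measure (ℝ × Vec n)) :=
  {μ | IsProbabilityMeasure μ ∧ OnXi μ ∧ HasMomentP (fun z => nrm z.2) p μ ∧
    WassersteinD (xiCost nrm) p μ μ₀ ≤ ENNReal.ofReal ε}

/-- The deviation-type functional `𝒱^F(β^⊤Z) = inf_t E^F[ℓ(β^⊤Z,t)^p]`. -/
def VInfT {n : ℕ} (ℓ : ℝ → ℝ → ℝ) (p : ℝ) (F : Measure (Vec n)) (β : Vec n) : ℝ :=
  sInf {r | ∃ t : ℝ, r = ∫ x, ℓ (dotp β x) t ^ p ∂F}


namespace IsNorm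

variable {n : ℕ} {nrm : Vec n → ℝ}

lemma map_zero (h : IsNorm nrm) : nrm 0 = 0 := (h.1 0).2 rfl

lemma map_neg (h : IsNorm nrm) (x : Vec n) : nrm (-x) = nrm x := by
  simpa using h.2.1 (-1) x

lemma nonneg (h : IsNorm nrm) (x : Vec n) : 0 ≤ nrm x := by
  have := h.2.2 x (-x)
  rw [h.map_neg, add_neg_cancel, h.map_zero] at this
  linarith

lemma convexOn (h : IsNorm nrm) : ConvexOn ℝ univ nrm := by
  refine ⟨convex_univ, fun x _ y _ a b ha hb _ => ?_⟩
  have := h.2.2 (a • x) (b • y)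
  rwa [h.2.1, h.2.1, abs_of_nonneg ha, abs_of_nonneg hb] at this

lemma continuous (h : IsNorm nrm) : Continuous nrm := h.convexOn.locallyLipschitz.continuous

/-- Every norm on `ℝⁿ` dominates a multiple of the sup norm. -/
lemma exists_norm_le (h : IsNorm nrm) : ∃ C : ℝ, 0 ≤ C ∧ ∀ x, ‖x‖ ≤ C * nrm x := by
  rcases (Metric.sphere (0 : Vec n) 1).eq_empty_or_nonempty with he | hne
  · refine ⟨0, le_rfl, fun x => ?_⟩
    by_contra! hx
    have hx0 : ‖x‖ ≠ 0 := by rw [zero_mul] at hx; exact hx.ne'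
    have : ‖x‖⁻¹ • x ∈ Metric.sphere (0 : Vec n) 1 := by
      simp [norm_smul, inv_mul_cancel₀ hx0]
    simp [he] at this
  · obtain ⟨u, hu, hmin⟩ := (isCompact_sphere (0 : Vec n) 1).exists_isMinOn hne
      h.continuous.continuousOn
    have hu1 : ‖u‖ = 1 := by simpa using hu
    have hupos : 0 < nrm u := by
      refine lt_of_le_of_ne (h.nonneg u) fun h0 => ?_
      have := (h.1 u).1 h0.symm
      simp [this] at hu1
    refine ⟨(nrm u)⁻¹, by positivity, fun x => ?_⟩
    rcases eq_or_ne x 0 with rfl | hx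
    · simp [h.map_zero]
    have hxn : 0 < ‖x‖ := norm_pos_iff.2 hx
    have hmem : ‖x‖⁻¹ • x ∈ Metric.sphere (0 : Vec n) 1 := by
      simp [norm_smul, inv_mul_cancel₀ hxn.ne']
    have hle : nrm u ≤ nrm (‖x‖⁻¹ • x) := hmin hmem
    rw [h.2.1, abs_of_pos (inv_pos.2 hxn), le_inv_mul_iff₀ hxn] at hle
    rw [le_inv_mul_iff₀ hupos]
    linarith

end IsNorm

section DotProduct

variable {n : ℕ}

lemma dotp_add (β x y : Vec n) : dotp β (x + y) = dotp β x + dotp β y := by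
  simp [dotp, mul_add, Finset.sum_add_distrib]

lemma dotp_smul (β x : Vec n) (a : ℝ) : dotp β (a • x) = a * dotp β x := by
  simp only [dotp, Pi.smul_apply, smul_eq_mul, Finset.mul_sum]
  exact Finset.sum_congr rfl fun i _ => by ring

lemma dotp_sub (β x y : Vec n) : dotp β (x - y) = dotp β x - dotp β y := by
  simp [dotp, mul_sub, Finset.sum_sub_distrib]

lemma continuous_dotp (β : Vec n) : Continuous (dotp β) := by
  unfold dotp
  fun_prop

lemma exists_dotp_eq_dualNorm {nrm : Vec n → ℝ} (h : IsNorm nrm) (β : Vec n) :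
    ∃ v, nrm v ≤ 1 ∧ dotp β v = dualNorm nrm β ∧ 0 ≤ dualNorm nrm β ∧
      ∀ x, |dotp β x| ≤ dualNorm nrm β * nrm x := by
  obtain ⟨C, hC0, hC⟩ := h.exists_norm_le
  have hcpt : IsCompact {x : Vec n | nrm x ≤ 1} := by
    refine Metric.isCompact_of_isClosed_isBounded
      (isClosed_le h.continuous continuous_const) ?_
    refine (Metric.isBounded_closedBall (x := (0 : Vec n)) (r := C)).subset fun x hx => ?_
    rw [mem_closedBall_zero_iff]
    exact (hC x).trans (mul_le_of_le_one_right hC0 hx)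
  obtain ⟨v, hv, hmax⟩ := hcpt.exists_isMaxOn ⟨0, by simp [h.map_zero]⟩
    (continuous_dotp β).continuousOn
  have hd : dualNorm nrm β = dotp β v := by
    refine IsGreatest.csSup_eq ⟨⟨v, hv, rfl⟩, ?_⟩
    rintro _ ⟨x, hx, rfl⟩
    exact hmax hx
  have hd0 : 0 ≤ dotp β v := by
    have : dotp β 0 ≤ dotp β v := hmax (by simp [h.map_zero])
    simpa [dotp] using this
  refine ⟨v, hv, hd.symm, hd ▸ hd0, fun x => ?_⟩
  rw [hd]
  have key : ∀ x, dotp β x ≤ dotp β v * nrm x := by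
    intro x
    rcases eq_or_ne x 0 with rfl | hx
    · simp [h.map_zero, dotp]
    have hpos : 0 < nrm x := lt_of_le_of_ne (h.nonneg x) fun h0 => hx ((h.1 x).1 h0.symm)
    have hle : dotp β ((nrm x)⁻¹ • x) ≤ dotp β v := hmax (by
      simp [h.2.1, abs_of_pos hpos, inv_mul_cancel₀ hpos.ne'])
    rw [dotp_smul, inv_mul_le_iff₀ hpos] at hle
    linarith
  refine abs_le'.2 ⟨key x, ?_⟩
  have := key (-x)
  rw [h.map_neg] at this
  simpa [dotp] using this

end DotProduct

/-- The tangent line inequality for the convex function `x ↦ x ^ p`. -/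
lemma rpow_tangent_le {p a b : ℝ} (hp : 1 ≤ p) (ha : 0 ≤ a) (hb : 0 ≤ b) :
    a ^ p + p * a ^ (p - 1) * (b - a) ≤ b ^ p := by
  rcases ha.eq_or_lt with rfl | ha
  · rcases hp.eq_or_lt with rfl | hp
    · simp
    · rw [Real.zero_rpow (by linarith), Real.zero_rpow (by linarith)]
      simpa using Real.rpow_nonneg hb p
  · have h := one_add_mul_self_le_rpow_one_add (s := b / a - 1)
      (by linarith [div_nonneg hb ha.le]) hp
    rw [add_sub_cancel, Real.div_rpow hb ha.le, le_div_iff₀ (by positivity)] at h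
    refine le_trans (le_of_eq ?_) h
    rw [Real.rpow_sub_one ha.ne']
    field_simp

/-- A nonnegative `c`-Lipschitz loss `f` growing like `c|y - m|`, with a subgradient `c * s` such
that moving `y` in the direction `s y` in proportion to `f y` rescales `f` and preserves `s`. -/
structure IsExpandingLoss (f s : ℝ → ℝ) (c m K : ℝ) : Prop where
  nonneg : ∀ y, 0 ≤ f y
  lipschitz : ∀ y z, f y ≤ f z + c * |y - z|
  measurable_dir : Measurable s
  abs_dir_le : ∀ y, |s y| ≤ 1
  subgradient : ∀ y z, f y + c * s y * (z - y) ≤ f z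
  expand : ∀ r y, 0 ≤ r → f (y + r * s y * f y) = (1 + c * r) * f y
  dir_expand : ∀ r y, 0 ≤ r → s (y + r * s y * f y) = s y
  coercive : ∀ y, c * (|y - m| - K) ≤ f y

lemma isExpandingLoss_deadZone {c : ℝ} (hc : 0 ≤ c) (m : ℝ) {K : ℝ} (hK : 0 ≤ K) :
    IsExpandingLoss (fun x => c * max (|x - m| - K) 0)
      (fun x => if K < x - m then 1 else if x - m < -K then -1 else 0) c m K where
  nonneg y := mul_nonneg hc (le_max_right _ _)
  lipschitz y z := by
    rw [← mul_add]
    refine mul_le_mul_of_nonneg_left (max_le ?_ ?_) hc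
    · have := abs_sub_le y z m
      linarith [le_max_left (|z - m| - K) 0]
    · linarith [le_max_right (|z - m| - K) 0, abs_nonneg (y - z)]
  measurable_dir := by
    refine Measurable.ite (measurableSet_lt measurable_const (by fun_prop)) measurable_const
      (Measurable.ite (measurableSet_lt (by fun_prop) measurable_const) measurable_const
        measurable_const)
  abs_dir_le y := by split_ifs <;> simp
  subgradient y z := by
    have e : ∀ a b : ℝ, c * a + c * b * (z - y) = c * (a + b * (z - y)) := fun a b => by ring
    simp only [e]
    refine mul_le_mul_of_nonneg_left ?_ hc
    split_ifs with h1 h2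
    · rw [abs_of_pos (by linarith), max_eq_left (by linarith)]
      exact le_trans (by linarith [le_abs_self (z - m)]) (le_max_left _ _)
    · rw [abs_of_neg (by linarith), max_eq_left (by linarith)]
      exact le_trans (by linarith [neg_abs_le (z - m)]) (le_max_left _ _)
    · rw [max_eq_right (by linarith [abs_le.2 ⟨not_lt.1 h2, not_lt.1 h1⟩])]
      simp
  expand r y hr := by
    have hcr : 0 ≤ c * r := mul_nonneg hc hr
    split_ifs with h1 h2
    · rw [abs_of_pos (a := y - m) (by linarith), max_eq_left (a := y - m - K) (by linarith)]
      have : 0 ≤ c * r * (y - m - K) := mul_nonneg hcr (by linarith)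
      have e : y + r * 1 * (c * (y - m - K)) - m = y - m + c * r * (y - m - K) := by ring
      rw [e, abs_of_pos (by linarith), max_eq_left (by linarith)]
      ring
    · rw [abs_of_neg (a := y - m) (by linarith), max_eq_left (a := -(y - m) - K) (by linarith)]
      have : 0 ≤ c * r * (-(y - m) - K) := mul_nonneg hcr (by linarith)
      have e : y + r * -1 * (c * (-(y - m) - K)) - m = y - m - c * r * (-(y - m) - K) := by ring
      rw [e, abs_of_neg (by linarith), max_eq_left (by linarith)]
      ring
    · have := abs_le.2 ⟨not_lt.1 h2, not_lt.1 h1⟩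
      rw [mul_zero, zero_mul, add_zero, max_eq_right (by linarith)]
      ring
  dir_expand r y hr := by
    have hcr : 0 ≤ c * r := mul_nonneg hc hr
    by_cases h1 : K < y - m
    · have : 0 ≤ c * r * (y - m - K) := mul_nonneg hcr (by linarith)
      have e : y + r * 1 * (c * (y - m - K)) - m = y - m + c * r * (y - m - K) := by ring
      rw [if_pos h1, abs_of_pos (a := y - m) (by linarith),
        max_eq_left (a := y - m - K) (by linarith), e, if_pos (by linarith)]
    · by_cases h2 : y - m < -K
      · have : 0 ≤ c * r * (-(y - m) - K) := mul_nonneg hcr (by linarith)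
        have e : y + r * -1 * (c * (-(y - m) - K)) - m = y - m - c * r * (-(y - m) - K) := by
          ring
        rw [if_neg h1, if_pos h2, abs_of_neg (a := y - m) (by linarith),
          max_eq_left (a := -(y - m) - K) (by linarith), e, if_neg (by linarith),
          if_pos (by linarith)]
      · simp [h1, h2]
  coercive y := mul_le_mul_of_nonneg_left (le_max_left _ _) hc

lemma isExpandingLoss_abs_add {c : ℝ} (hc : 0 ≤ c) (m : ℝ) {b : ℝ} (hb : 0 < b) :
    IsExpandingLoss (fun x => c * (|x - m| + b)) (fun x => if m ≤ x then 1 else -1) c m 0 where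
  nonneg y := by positivity
  lipschitz y z := by
    rw [← mul_add]
    refine mul_le_mul_of_nonneg_left ?_ hc
    linarith [abs_sub_le y z m]
  measurable_dir := Measurable.ite measurableSet_Ici measurable_const measurable_const
  abs_dir_le y := by split_ifs <;> simp
  subgradient y z := by
    have e : ∀ a b : ℝ, c * a + c * b * (z - y) = c * (a + b * (z - y)) := fun a b => by ring
    simp only [e]
    refine mul_le_mul_of_nonneg_left ?_ hc
    split_ifs with h1
    · rw [abs_of_nonneg (by linarith)]
      linarith [le_abs_self (z - m)]
    · rw [abs_of_neg (by linarith)]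
      linarith [neg_abs_le (z - m)]
  expand r y hr := by
    have hcr : 0 ≤ c * r := mul_nonneg hc hr
    split_ifs with h1
    · rw [abs_of_nonneg (a := y - m) (by linarith)]
      have : 0 ≤ c * r * (y - m + b) := mul_nonneg hcr (by linarith)
      have e : y + r * 1 * (c * (y - m + b)) - m = y - m + c * r * (y - m + b) := by ring
      rw [e, abs_of_nonneg (by linarith)]
      ring
    · rw [abs_of_neg (a := y - m) (by linarith)]
      have : 0 ≤ c * r * (-(y - m) + b) := mul_nonneg hcr (by linarith)
      have e : y + r * -1 * (c * (-(y - m) + b)) - m = y - m - c * r * (-(y - m) + b) := by ring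
      rw [e, abs_of_neg (by linarith)]
      ring
  dir_expand r y hr := by
    have hcr : 0 ≤ r * (c * (|y - m| + b)) := by positivity
    by_cases h1 : m ≤ y
    · rw [if_pos h1, if_pos (by linarith)]
    · rw [if_neg h1, if_neg (by linarith)]
  coercive y := mul_le_mul_of_nonneg_left (by linarith) hc

section Transport

variable {n : ℕ} {nrm : Vec n → ℝ} {p : ℝ}

/-- `F` is a probability measure that can be transported to `μ` at cost (in `p`-th power) at most
`a`. -/
def TransportLE (nrm : Vec n → ℝ) (p : ℝ) (μ F : Measure (Vec n)) (a : ℝ≥0∞) : Prop :=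
  IsProbabilityMeasure F ∧ ∃ π ∈ Couplings F μ,
    ∫⁻ z, ENNReal.ofReal (nrm (z.1 - z.2)) ^ p ∂π ≤ a

lemma hasMomentP_iff_memLp (h : IsNorm nrm) (hp : 1 ≤ p) (μ : Measure (Vec n)) :
    HasMomentP nrm (ENNReal.ofReal p) μ ↔ MemLp nrm (ENNReal.ofReal p) μ := by
  have hp0 : ENNReal.ofReal p ≠ 0 := by simp; linarith
  rw [HasMomentP, if_neg ENNReal.ofReal_ne_top, MemLp,
    and_iff_right h.continuous.aestronglyMeasurable,
    eLpNorm_lt_top_iff_lintegral_rpow_enorm_lt_top hp0 ENNReal.ofReal_ne_top, lt_top_iff_ne_top]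
  simp_rw [Real.enorm_of_nonneg (h.nonneg _)]

/-- Minkowski's inequality for a function that is Lipschitz with respect to `nrm`. -/
lemma eLpNorm_le_of_coupling (h : IsNorm nrm) (hp : 1 ≤ p) {F μ : Measure (Vec n)}
    {π : Measure (Vec n × Vec n)} (hπ : π ∈ Couplings F μ) {g : Vec n → ℝ} (hg : Measurable g)
    {L : ℝ} (hL : 0 ≤ L) (hgL : ∀ x y, |g x| ≤ |g y| + L * nrm (x - y)) :
    eLpNorm g (ENNReal.ofReal p) F ≤ eLpNorm g (ENNReal.ofReal p) μ +
      ENNReal.ofReal L * (∫⁻ z, ENNReal.ofReal (nrm (z.1 - z.2)) ^ p ∂π) ^ (1 / p) := by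
  have hp0 : ENNReal.ofReal p ≠ 0 := by simp; linarith
  have hp1 : 1 ≤ ENNReal.ofReal p := by simpa using hp
  have hnm := h.continuous.measurable
  obtain ⟨_, h1, h2⟩ := hπ
  rw [← h1, ← h2, eLpNorm_map_measure hg.aestronglyMeasurable measurable_fst.aemeasurable,
    eLpNorm_map_measure hg.aestronglyMeasurable measurable_snd.aemeasurable]
  have hmono : eLpNorm (g ∘ Prod.fst) (ENNReal.ofReal p) π
      ≤ eLpNorm ((fun z => ‖g z.2‖) + L • fun z => nrm (z.1 - z.2)) (ENNReal.ofReal p) π :=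
    eLpNorm_mono_real fun z => by simpa using hgL z.1 z.2
  have hadd : eLpNorm ((fun z => ‖g z.2‖) + L • fun z => nrm (z.1 - z.2)) (ENNReal.ofReal p) π ≤
      eLpNorm (fun z => ‖g z.2‖) (ENNReal.ofReal p) π +
        eLpNorm (L • fun z => nrm (z.1 - z.2)) (ENNReal.ofReal p) π :=
    eLpNorm_add_le (Measurable.aestronglyMeasurable (by fun_prop))
      (Measurable.aestronglyMeasurable (by fun_prop)) hp1
  have hsnd : eLpNorm (fun z : Vec n × Vec n => ‖g z.2‖) (ENNReal.ofReal p) π =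
      eLpNorm (g ∘ Prod.snd) (ENNReal.ofReal p) π := eLpNorm_norm (g ∘ Prod.snd)
  have hcost : eLpNorm (L • fun z : Vec n × Vec n => nrm (z.1 - z.2)) (ENNReal.ofReal p) π =
      ENNReal.ofReal L * (∫⁻ z, ENNReal.ofReal (nrm (z.1 - z.2)) ^ p ∂π) ^ (1 / p) := by
    rw [eLpNorm_const_smul, Real.enorm_of_nonneg hL,
      eLpNorm_eq_lintegral_rpow_enorm_toReal hp0 ENNReal.ofReal_ne_top,
      ENNReal.toReal_ofReal (zero_le_one.trans hp)]
    simp_rw [Real.enorm_of_nonneg (h.nonneg _)]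
  rw [hsnd, hcost] at hadd
  exact hmono.trans hadd

lemma TransportLE.memLp (h : IsNorm nrm) (hp : 1 ≤ p) {F μ : Measure (Vec n)} {a : ℝ≥0∞}
    (hF : TransportLE nrm p μ F a) (ha : a ≠ ∞) (hμ : MemLp nrm (ENNReal.ofReal p) μ) :
    MemLp nrm (ENNReal.ofReal p) F := by
  obtain ⟨_, π, hπ, hle⟩ := hF
  refine ⟨h.continuous.aestronglyMeasurable, ?_⟩
  refine (eLpNorm_le_of_coupling h hp hπ h.continuous.measurable zero_le_one fun x y => ?_).trans_lt
    (ENNReal.add_lt_top.2 ⟨hμ.2, ENNReal.mul_lt_top ENNReal.ofReal_lt_top ?_⟩)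
  · rw [abs_of_nonneg (h.nonneg _), abs_of_nonneg (h.nonneg _)]
    simpa using h.2.2 y (x - y)
  · exact ENNReal.rpow_lt_top_of_nonneg (by positivity) (hle.trans_lt ha.lt_top).ne

lemma TransportLE.mem_wballVec (h : IsNorm nrm) (hp : 1 ≤ p) {F μ : Measure (Vec n)}
    (hμ : MemLp nrm (ENNReal.ofReal p) μ) {ε : ℝ}
    (hF : TransportLE nrm p μ F (ENNReal.ofReal ε ^ p)) :
    F ∈ WballVec nrm (ENNReal.ofReal p) μ ε := by
  have hp0 : 0 < p := by linarith
  refine ⟨hF.1, (hasMomentP_iff_memLp h hp F).2 (hF.memLp h hp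
    (ENNReal.rpow_lt_top_of_nonneg hp0.le ENNReal.ofReal_ne_top).ne hμ), ?_⟩
  obtain ⟨_, π, hπ, hle⟩ := hF
  rw [WassersteinD, if_neg ENNReal.ofReal_ne_top, ENNReal.toReal_ofReal hp0.le]
  refine (iInf₂_le π hπ).trans ?_
  rwa [one_div, ENNReal.rpow_inv_le_iff hp0]

lemma TransportLE.map (h : IsNorm nrm) {μ : Measure (Vec n)}
    [IsProbabilityMeasure μ] {T : Vec n → Vec n} (hT : Measurable T) {a : ℝ≥0∞}
    (ha : ∫⁻ x, ENNReal.ofReal (nrm (T x - x)) ^ p ∂μ ≤ a) :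
    TransportLE nrm p μ (μ.map T) a := by
  have hm : Measurable fun x => (T x, x) := hT.prodMk measurable_id
  have hn := h.continuous.measurable
  refine ⟨Measure.isProbabilityMeasure_map hT.aemeasurable, μ.map fun x => (T x, x),
    ⟨Measure.isProbabilityMeasure_map hm.aemeasurable, ?_, ?_⟩, ?_⟩
  · rw [Measure.map_map measurable_fst hm]; rfl
  · rw [Measure.map_map measurable_snd hm]; exact Measure.map_id
  · rwa [lintegral_map (by fun_prop) hm]

/-- The convex combination `θ μ + (1 - θ) ν`. -/
def mixture {E : Type*} [MeasurableSpace E] (θ : ℝ) (μ ν : Measure E) : Measure E :=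
  ENNReal.ofReal θ • μ + ENNReal.ofReal (1 - θ) • ν

lemma ofReal_add_ofReal_one_sub {θ : ℝ} (h0 : 0 ≤ θ) (h1 : θ ≤ 1) :
    ENNReal.ofReal θ + ENNReal.ofReal (1 - θ) = 1 := by
  rw [← ENNReal.ofReal_add h0 (by linarith)]
  simp

lemma isProbabilityMeasure_mixture {E : Type*} [MeasurableSpace E] {θ : ℝ} (h0 : 0 ≤ θ)
    (h1 : θ ≤ 1) (μ ν : Measure E) [IsProbabilityMeasure μ] [IsProbabilityMeasure ν] :
    IsProbabilityMeasure (mixture θ μ ν) :=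
  ⟨by simp [mixture, ofReal_add_ofReal_one_sub h0 h1]⟩

lemma TransportLE.mixture {μ F G : Measure (Vec n)} {a b : ℝ≥0∞} {θ : ℝ} (h0 : 0 ≤ θ)
    (h1 : θ ≤ 1) (hF : TransportLE nrm p μ F a) (hG : TransportLE nrm p μ G b) :
    TransportLE nrm p μ (mixture θ F G)
      (ENNReal.ofReal θ * a + ENNReal.ofReal (1 - θ) * b) := by
  obtain ⟨_, π, ⟨_, hπ1, hπ2⟩, hπ⟩ := hF
  obtain ⟨_, ρ, ⟨_, hρ1, hρ2⟩, hρ⟩ := hG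
  refine ⟨isProbabilityMeasure_mixture h0 h1 F G, _root_.mixture θ π ρ,
    ⟨isProbabilityMeasure_mixture h0 h1 π ρ, ?_, ?_⟩, ?_⟩
  · rw [_root_.mixture, Measure.map_add _ _ measurable_fst, Measure.map_smul, Measure.map_smul,
      hπ1, hρ1, _root_.mixture]
  · rw [_root_.mixture, Measure.map_add _ _ measurable_snd, Measure.map_smul, Measure.map_smul,
      hπ2, hρ2, ← add_smul, ofReal_add_ofReal_one_sub h0 h1, one_smul]
  · rw [_root_.mixture, lintegral_add_measure, lintegral_smul_measure, lintegral_smul_measure]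
    exact add_le_add (mul_le_mul_right hπ _) (mul_le_mul_right hρ _)

lemma integral_mixture {E : Type*} [MeasurableSpace E] {θ : ℝ} (h0 : 0 ≤ θ) (h1 : θ ≤ 1)
    {μ ν : Measure E} {g : E → ℝ} (hμ : Integrable g μ) (hν : Integrable g ν) :
    ∫ x, g x ∂(mixture θ μ ν) = θ * ∫ x, g x ∂μ + (1 - θ) * ∫ x, g x ∂ν := by
  rw [mixture, integral_add_measure (hμ.smul_measure ENNReal.ofReal_ne_top)
    (hν.smul_measure ENNReal.ofReal_ne_top), integral_smul_measure, integral_smul_measure,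
    ENNReal.toReal_ofReal h0, ENNReal.toReal_ofReal (by linarith), smul_eq_mul, smul_eq_mul]

end Transport

section Loss

variable {n : ℕ} {nrm : Vec n → ℝ} {p : ℝ} {f s : ℝ → ℝ} {c m K : ℝ}

lemma IsExpandingLoss.continuous (hf : IsExpandingLoss f s c m K) (hc : 0 ≤ c) :
    Continuous f := by
  refine (LipschitzWith.of_dist_le_mul (K := c.toNNReal) fun y z => ?_).continuous
  rw [Real.coe_toNNReal c hc, Real.dist_eq, Real.dist_eq, abs_sub_le_iff]
  have h1 := hf.lipschitz y z
  have h2 := hf.lipschitz z y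
  rw [abs_sub_comm z y] at h2
  constructor <;> linarith

lemma IsExpandingLoss.memLp (hf : IsExpandingLoss f s c m K) (hc : 0 ≤ c) (h : IsNorm nrm)
    {F : Measure (Vec n)} [IsProbabilityMeasure F]
    (hF : MemLp nrm (ENNReal.ofReal p) F) (β : Vec n) (t : ℝ) :
    MemLp (fun x => f (dotp β x - t)) (ENNReal.ofReal p) F := by
  obtain ⟨v, -, -, hd, hβ⟩ := exists_dotp_eq_dualNorm h β
  have hcont : Continuous fun x => f (dotp β x - t) :=
    (hf.continuous hc).comp ((continuous_dotp β).sub continuous_const)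
  refine MemLp.mono' ((memLp_const (f (-t))).add (hF.const_mul (c * dualNorm nrm β)))
    hcont.aestronglyMeasurable (.of_forall fun x => ?_)
  rw [Real.norm_of_nonneg (hf.nonneg _)]
  have h1 := hf.lipschitz (dotp β x - t) (-t)
  rw [sub_neg_eq_add, sub_add_cancel] at h1
  have h2 := mul_le_mul_of_nonneg_left (hβ x) hc
  simp only [Pi.add_apply]
  linarith

lemma IsExpandingLoss.integrable (hf : IsExpandingLoss f s c m K) (hc : 0 ≤ c) (h : IsNorm nrm)
    (hp : 1 ≤ p) {F : Measure (Vec n)} [IsProbabilityMeasure F]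
    (hF : MemLp nrm (ENNReal.ofReal p) F) (β : Vec n) (t : ℝ) :
    Integrable (fun x => f (dotp β x - t) ^ p) F := by
  have := (hf.memLp hc h hF β t).integrable_norm_rpow (by simp; linarith) ENNReal.ofReal_ne_top
  simpa only [Real.norm_of_nonneg (hf.nonneg _), ENNReal.toReal_ofReal (zero_le_one.trans hp)]
    using this

lemma IsExpandingLoss.eLpNorm_eq (hf : IsExpandingLoss f s c m K) (hc : 0 ≤ c) (h : IsNorm nrm)
    (hp : 1 ≤ p) {F : Measure (Vec n)} [IsProbabilityMeasure F]
    (hF : MemLp nrm (ENNReal.ofReal p) F) (β : Vec n) (t : ℝ) :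
    eLpNorm (fun x => f (dotp β x - t)) (ENNReal.ofReal p) F =
      ENNReal.ofReal ((∫ x, f (dotp β x - t) ^ p ∂F) ^ (1 / p)) := by
  rw [(hf.memLp hc h hF β t).eLpNorm_eq_integral_rpow_norm (by simp; linarith)
    ENNReal.ofReal_ne_top]
  simp only [Real.norm_of_nonneg (hf.nonneg _), ENNReal.toReal_ofReal (zero_le_one.trans hp),
    one_div]

lemma IsExpandingLoss.integral_nonneg (hf : IsExpandingLoss f s c m K) (p : ℝ)
    (F : Measure (Vec n)) (β : Vec n) (t : ℝ) : 0 ≤ ∫ x, f (dotp β x - t) ^ p ∂F :=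
  MeasureTheory.integral_nonneg fun _ => Real.rpow_nonneg (hf.nonneg _) _

lemma IsExpandingLoss.vInfT_le (hf : IsExpandingLoss f s c m K) (p : ℝ)
    (F : Measure (Vec n)) (β : Vec n) (t : ℝ) :
    VInfT (fun z t => f (z - t)) p F β ≤ ∫ x, f (dotp β x - t) ^ p ∂F :=
  csInf_le ⟨0, by rintro _ ⟨t, rfl⟩; exact hf.integral_nonneg p F β t⟩ ⟨t, rfl⟩

lemma le_vInfT {a : ℝ} {F : Measure (Vec n)} {β : Vec n}
    (ha : ∀ t, a ≤ ∫ x, f (dotp β x - t) ^ p ∂F) :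
    a ≤ VInfT (fun z t => f (z - t)) p F β :=
  le_csInf ⟨_, 0, rfl⟩ (by rintro _ ⟨t, rfl⟩; exact ha t)

lemma IsExpandingLoss.vInfT_nonneg (hf : IsExpandingLoss f s c m K) (p : ℝ)
    (F : Measure (Vec n)) (β : Vec n) : 0 ≤ VInfT (fun z t => f (z - t)) p F β :=
  le_vInfT fun t => hf.integral_nonneg p F β t

/-- Every distribution in the Wasserstein ball obeys the regularized bound. -/
lemma IsExpandingLoss.vInfT_le_of_mem_wballVec (hf : IsExpandingLoss f s c m K) (hc : 0 ≤ c)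
    (h : IsNorm nrm) (hp : 1 ≤ p) {μ F : Measure (Vec n)} [IsProbabilityMeasure μ]
    (hμ : MemLp nrm (ENNReal.ofReal p) μ) {ε : ℝ} (hε : 0 ≤ ε)
    (hF : F ∈ WballVec nrm (ENNReal.ofReal p) μ ε) (β : Vec n) :
    VInfT (fun z t => f (z - t)) p F β ≤
      (VInfT (fun z t => f (z - t)) p μ β ^ (1 / p) + c * ε * dualNorm nrm β) ^ p := by
  obtain ⟨hFp, hFm, hW⟩ := hF
  rw [hasMomentP_iff_memLp h hp] at hFm
  have hp0 : 0 < p := by linarith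
  obtain ⟨v, -, -, hd, hβ⟩ := exists_dotp_eq_dualNorm h β
  set d := dualNorm nrm β
  have hmeas : ∀ t, Measurable fun x => f (dotp β x - t) := fun t =>
    ((hf.continuous hc).comp ((continuous_dotp β).sub continuous_const)).measurable
  have hcd : 0 ≤ c * d := mul_nonneg hc hd
  have hlip : ∀ t x y, |f (dotp β x - t)| ≤ |f (dotp β y - t)| + c * d * nrm (x - y) := by
    intro t x y
    rw [abs_of_nonneg (hf.nonneg _), abs_of_nonneg (hf.nonneg _)]
    have h1 := hf.lipschitz (dotp β x - t) (dotp β y - t)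
    rw [sub_sub_sub_cancel_right, ← dotp_sub] at h1
    have h2 := mul_le_mul_of_nonneg_left (hβ (x - y)) hc
    linarith
  have hδ : ∀ t, ∀ δ > 0, (∫ x, f (dotp β x - t) ^ p ∂F) ^ (1 / p) ≤
      (∫ x, f (dotp β x - t) ^ p ∂μ) ^ (1 / p) + c * d * (ε + δ) := by
    intro t δ hδ
    rw [WassersteinD, if_neg ENNReal.ofReal_ne_top, ENNReal.toReal_ofReal hp0.le] at hW
    have hlt := hW.trans_lt ((ENNReal.ofReal_lt_ofReal_iff (by linarith)).2
      (lt_add_of_pos_right ε hδ))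
    simp only [iInf_lt_iff] at hlt
    obtain ⟨π, hπ, hlt⟩ := hlt
    have hle := eLpNorm_le_of_coupling h hp hπ (hmeas t) hcd (hlip t)
    rw [hf.eLpNorm_eq hc h hp hFm, hf.eLpNorm_eq hc h hp hμ] at hle
    have hA := Real.rpow_nonneg (hf.integral_nonneg p μ β t) (1 / p)
    have hle' := hle.trans (add_le_add_right (mul_le_mul_right hlt.le _) _)
    rw [← ENNReal.ofReal_mul hcd, ← ENNReal.ofReal_add hA (by positivity),
      ENNReal.ofReal_le_ofReal_iff (by positivity)] at hle'
    exact hle'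
  have hbound : ∀ t, (∫ x, f (dotp β x - t) ^ p ∂F) ^ (1 / p) ≤
      (∫ x, f (dotp β x - t) ^ p ∂μ) ^ (1 / p) + c * ε * d := by
    intro t
    refine le_of_forall_pos_le_add fun η hη => ?_
    refine (hδ t (η / (c * d + 1)) (by positivity)).trans ?_
    have : c * d * (η / (c * d + 1)) ≤ η := by
      rw [mul_div_assoc', div_le_iff₀ (by positivity)]
      nlinarith
    linarith
  have hV := hf.vInfT_nonneg p F β
  have hV0 := hf.vInfT_nonneg p μ β
  set V := VInfT (fun z t => f (z - t)) p F β
  have hVt : ∀ t, V ^ (1 / p) ≤ (∫ x, f (dotp β x - t) ^ p ∂μ) ^ (1 / p) + c * ε * d := fun t =>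
    (Real.rpow_le_rpow hV (hf.vInfT_le p F β t) (by positivity)).trans (hbound t)
  have hmain : V ^ (1 / p) ≤ VInfT (fun z t => f (z - t)) p μ β ^ (1 / p) + c * ε * d := by
    rcases le_total (V ^ (1 / p)) (c * ε * d) with hle | hle
    · exact hle.trans (le_add_of_nonneg_left (Real.rpow_nonneg hV0 _))
    · rw [← sub_le_iff_le_add, one_div, Real.le_rpow_inv_iff_of_pos (by simpa using hle) hV0 hp0]
      refine le_vInfT fun t => ?_
      rw [← Real.le_rpow_inv_iff_of_pos (by simpa using hle) (hf.integral_nonneg p μ β t) hp0]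
      simpa [sub_le_iff_le_add] using hVt t
  rw [one_div] at hmain
  rw [one_div]
  exact (Real.rpow_inv_le_iff_of_pos hV
    (add_nonneg (Real.rpow_nonneg hV0 _) (by positivity)) hp0).1 hmain

end Loss

section LowerBound

variable {n : ℕ} {nrm : Vec n → ℝ} {p : ℝ} {f s : ℝ → ℝ} {c m K : ℝ}

lemma measurable_loss_rpow (hf : IsExpandingLoss f s c m K) (hc : 0 ≤ c) (p : ℝ) (β : Vec n)
    (t : ℝ) : Measurable fun x => f (dotp β x - t) ^ p :=
  (((hf.continuous hc).comp ((continuous_dotp β).sub continuous_const)).measurable).pow_const p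

/-- Moving a small mass far away in opposite directions along `v`. -/
lemma IsExpandingLoss.exists_symmetric_spread (hf : IsExpandingLoss f s c m K) (hc : 0 ≤ c)
    (h : IsNorm nrm) (hp : 1 ≤ p) {μ : Measure (Vec n)} [IsProbabilityMeasure μ]
    (hμ : MemLp nrm (ENNReal.ofReal p) μ) {ε : ℝ} (hε : 0 ≤ ε) {β v : Vec n} (hv : nrm v ≤ 1)
    {R : ℝ} (hR : 0 < R) (hεR : ε ≤ R) (hRK : 0 ≤ dotp β v - K / R) :
    ∃ F ∈ WballVec nrm (ENNReal.ofReal p) μ ε,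
      (c * ε * (dotp β v - K / R)) ^ p ≤ VInfT (fun z t => f (z - t)) p F β := by
  have hp0 : 0 < p := by linarith
  have hTm : ∀ r : ℝ, Measurable fun x : Vec n => x + r • v := fun r => by fun_prop
  have hcost : ∀ r : ℝ, |r| = R →
      TransportLE nrm p μ (μ.map fun x => x + r • v) (ENNReal.ofReal R ^ p) := by
    intro r hr
    refine TransportLE.map h (hTm r) ?_
    simp only [add_sub_cancel_left, lintegral_const, measure_univ, mul_one]
    refine ENNReal.rpow_le_rpow (ENNReal.ofReal_le_ofReal ?_) hp0.le
    rw [h.2.1, hr]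
    exact mul_le_of_le_one_right hR.le hv
  have hfin : ENNReal.ofReal R ^ p ≠ ∞ :=
    (ENNReal.rpow_lt_top_of_nonneg hp0.le ENNReal.ofReal_ne_top).ne
  have hF1 := hcost R (abs_of_pos hR)
  have hF2 := hcost (-R) (by rw [abs_neg, abs_of_pos hR])
  have hid : TransportLE nrm p μ μ 0 := by
    have := TransportLE.map h (T := id) (μ := μ) (p := p) (a := 0) measurable_id
      (by simp [h.map_zero, hp0])
    rwa [Measure.map_id] at this
  have hhalf := hF1.mixture (θ := 1 / 2) (by norm_num) (by norm_num) hF2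
  rw [← add_mul, ofReal_add_ofReal_one_sub (by norm_num) (by norm_num), one_mul] at hhalf
  set q := (ε / R) ^ p with hq
  have hq0 : 0 ≤ q := by positivity
  have hq1 : q ≤ 1 := Real.rpow_le_one (by positivity) ((div_le_one hR).2 hεR) hp0.le
  have hqR : ENNReal.ofReal q * ENNReal.ofReal R ^ p = ENNReal.ofReal ε ^ p := by
    rw [ENNReal.ofReal_rpow_of_nonneg hR.le hp0.le, ENNReal.ofReal_rpow_of_nonneg hε hp0.le,
      ← ENNReal.ofReal_mul hq0, hq, Real.div_rpow hε hR.le, div_mul_cancel₀]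
    positivity
  have hF := hhalf.mixture hq0 hq1 hid
  rw [mul_zero, add_zero, hqR] at hF
  refine ⟨_, hF.mem_wballVec h hp hμ, le_vInfT fun τ => ?_⟩
  have hF1p := hF1.1
  have hF2p := hF2.1
  have hhp := hhalf.1
  have i1 := hf.integrable hc h hp (hF1.memLp h hp hfin hμ) β τ
  have i2 := hf.integrable hc h hp (hF2.memLp h hp hfin hμ) β τ
  have i12 := hf.integrable hc h hp (hhalf.memLp h hp hfin hμ) β τ
  have i0 := hf.integrable hc h hp hμ β τ
  rw [integral_mixture hq0 hq1 i12 i0, integral_mixture (by norm_num) (by norm_num) i1 i2]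
  have hm := measurable_loss_rpow hf hc p β τ
  rw [integral_map (hTm R).aemeasurable hm.aestronglyMeasurable,
    integral_map (hTm (-R)).aemeasurable hm.aestronglyMeasurable]
  have j1 : Integrable (fun x => f (dotp β (x + R • v) - τ) ^ p) μ :=
    (integrable_map_measure hm.aestronglyMeasurable (hTm R).aemeasurable).1 i1
  have j2 : Integrable (fun x => f (dotp β (x + (-R) • v) - τ) ^ p) μ :=
    (integrable_map_measure hm.aestronglyMeasurable (hTm (-R)).aemeasurable).1 i2
  have hb : 0 ≤ c * (R * dotp β v - K) := by
    refine mul_nonneg hc ?_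
    have e : R * dotp β v - K = R * (dotp β v - K / R) := by field_simp
    rw [e]
    positivity
  have hpt : ∀ x, (c * (R * dotp β v - K)) ^ p ≤
      1 / 2 * f (dotp β (x + R • v) - τ) ^ p +
        (1 - 1 / 2) * f (dotp β (x + (-R) • v) - τ) ^ p := by
    intro x
    simp only [dotp_add, dotp_smul]
    have t1 := rpow_tangent_le hp hb (hf.nonneg (dotp β x + R * dotp β v - τ))
    have t2 := rpow_tangent_le hp hb (hf.nonneg (dotp β x + -R * dotp β v - τ))
    have c1 := hf.coercive (dotp β x + R * dotp β v - τ)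
    have c2 := hf.coercive (dotp β x + -R * dotp β v - τ)
    have hsum : 2 * (c * (R * dotp β v - K)) ≤
        f (dotp β x + R * dotp β v - τ) + f (dotp β x + -R * dotp β v - τ) := by
      have a1 := le_abs_self (dotp β x + R * dotp β v - τ - m)
      have a2 := neg_abs_le (dotp β x + -R * dotp β v - τ - m)
      have := mul_le_mul_of_nonneg_left (show 2 * (R * dotp β v - K) ≤
        (|dotp β x + R * dotp β v - τ - m| - K) +
          (|dotp β x + -R * dotp β v - τ - m| - K) by linarith) hc
      linarith
    have hk : 0 ≤ p * (c * (R * dotp β v - K)) ^ (p - 1) := by positivity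
    have := mul_nonneg hk (sub_nonneg.2 hsum)
    linarith
  have hint : (c * (R * dotp β v - K)) ^ p ≤
      1 / 2 * ∫ x, f (dotp β (x + R • v) - τ) ^ p ∂μ +
        (1 - 1 / 2) * ∫ x, f (dotp β (x + (-R) • v) - τ) ^ p ∂μ := by
    rw [← integral_const_mul, ← integral_const_mul,
      ← integral_add (j1.const_mul _) (j2.const_mul _)]
    calc (c * (R * dotp β v - K)) ^ p = ∫ _, (c * (R * dotp β v - K)) ^ p ∂μ := by simp
      _ ≤ _ := integral_mono (integrable_const _) ((j1.const_mul _).add (j2.const_mul _)) hpt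
  have e : (c * ε * (dotp β v - K / R)) ^ p = q * (c * (R * dotp β v - K)) ^ p := by
    rw [hq, ← Real.mul_rpow (by positivity) hb]
    congr 1
    field_simp
  rw [e]
  have := mul_le_mul_of_nonneg_left hint hq0
  have := mul_nonneg (sub_nonneg.2 hq1) (hf.integral_nonneg p μ β τ)
  linarith

/-- The (negated) derivative in `t` of `E[f(β^⊤Z - t)^p]`, computed with the subgradient `c * s`. -/
def lossSlope (f s : ℝ → ℝ) (c p : ℝ) (μ : Measure (Vec n)) (β : Vec n) (t : ℝ) : ℝ :=
  ∫ x, p * f (dotp β x - t) ^ (p - 1) * (c * s (dotp β x - t)) ∂μ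

lemma IsExpandingLoss.rpow_subgradient (hf : IsExpandingLoss f s c m K) (hp : 1 ≤ p) (y z : ℝ) :
    f y ^ p + p * f y ^ (p - 1) * (c * s y) * (z - y) ≤ f z ^ p := by
  have h1 := rpow_tangent_le hp (hf.nonneg y) (hf.nonneg z)
  have h2 : 0 ≤ p * f y ^ (p - 1) :=
    mul_nonneg (by linarith) (Real.rpow_nonneg (hf.nonneg y) _)
  have h3 := mul_le_mul_of_nonneg_left (hf.subgradient y z) h2
  nlinarith

lemma IsExpandingLoss.integrable_slope (hf : IsExpandingLoss f s c m K) (hc : 0 ≤ c)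
    (h : IsNorm nrm) (hp : 1 ≤ p) {μ : Measure (Vec n)} [IsProbabilityMeasure μ]
    (hμ : MemLp nrm (ENNReal.ofReal p) μ) (β : Vec n) (t : ℝ) :
    Integrable (fun x => p * f (dotp β x - t) ^ (p - 1) * (c * s (dotp β x - t))) μ := by
  have hms : Measurable fun x => s (dotp β x - t) :=
    hf.measurable_dir.comp ((continuous_dotp β).measurable.sub_const t)
  refine Integrable.mono' (((integrable_const (1 : ℝ)).add
    (hf.integrable hc h hp hμ β t)).const_mul (p * c))
    (((measurable_loss_rpow hf hc (p - 1) β t).const_mul p).mul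
      (hms.const_mul c)).aestronglyMeasurable (.of_forall fun x => ?_)
  set y := dotp β x - t
  have hy := hf.nonneg y
  have h1 : f y ^ (p - 1) ≤ 1 + f y ^ p := by
    rcases le_total (f y) 1 with hle | hle
    · linarith [Real.rpow_le_one hy hle (sub_nonneg.2 hp), Real.rpow_nonneg hy p]
    · linarith [Real.rpow_le_rpow_of_exponent_le hle (sub_le_self p zero_le_one)]
  have h0 := Real.rpow_nonneg hy (p - 1)
  rw [Real.norm_eq_abs, abs_mul, abs_mul, abs_mul, abs_of_nonneg (zero_le_one.trans hp),
    abs_of_nonneg h0, abs_of_nonneg hc]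
  calc p * f y ^ (p - 1) * (c * |s y|) ≤ p * f y ^ (p - 1) * (c * 1) :=
        mul_le_mul_of_nonneg_left (mul_le_mul_of_nonneg_left (hf.abs_dir_le y) hc)
          (mul_nonneg (by linarith) h0)
    _ = p * c * f y ^ (p - 1) := by ring
    _ ≤ p * c * (1 + f y ^ p) := mul_le_mul_of_nonneg_left h1 (mul_nonneg (by linarith) hc)

lemma IsExpandingLoss.add_lossSlope_mul_le (hf : IsExpandingLoss f s c m K) (hc : 0 ≤ c)
    (h : IsNorm nrm) (hp : 1 ≤ p) {μ : Measure (Vec n)} [IsProbabilityMeasure μ]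
    (hμ : MemLp nrm (ENNReal.ofReal p) μ) (β : Vec n) (t τ : ℝ) :
    ∫ x, f (dotp β x - t) ^ p ∂μ + lossSlope f s c p μ β t * (t - τ) ≤
      ∫ x, f (dotp β x - τ) ^ p ∂μ := by
  have i1 := hf.integrable hc h hp hμ β t
  have i2 := (hf.integrable_slope hc h hp hμ β t).mul_const (t - τ)
  rw [lossSlope, ← integral_mul_const, ← integral_add i1 i2]
  refine integral_mono (i1.add i2) (hf.integrable hc h hp hμ β τ) fun x => ?_
  have := hf.rpow_subgradient hp (dotp β x - t) (dotp β x - τ)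
  rwa [sub_sub_sub_cancel_left] at this

lemma IsExpandingLoss.exists_linear_growth (hf : IsExpandingLoss f s c m K) (hc : 0 ≤ c)
    (h : IsNorm nrm) (hp : 1 ≤ p) {μ : Measure (Vec n)} [IsProbabilityMeasure μ]
    (hμ : MemLp nrm (ENNReal.ofReal p) μ) (β : Vec n) :
    ∃ A, ∀ t, c * |t| ≤ A + ∫ x, f (dotp β x - t) ^ p ∂μ := by
  obtain ⟨v, -, -, hd, hβ⟩ := exists_dotp_eq_dualNorm h β
  have hni : Integrable nrm μ := hμ.integrable (by simpa using hp)
  have hY : Integrable (fun x => |dotp β x|) μ :=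
    (hni.const_mul (dualNorm nrm β)).mono'
      (continuous_dotp β).abs.aestronglyMeasurable (.of_forall fun x => by simpa using hβ x)
  refine ⟨∫ x, (c * |dotp β x| + (c * (|m| + K) + 1)) ∂μ, fun t => ?_⟩
  have i1 : Integrable (fun x => c * |dotp β x| + (c * (|m| + K) + 1)) μ :=
    (hY.const_mul c).add (integrable_const _)
  have i2 := hf.integrable hc h hp hμ β t
  rw [← integral_add i1 i2]
  calc c * |t| = ∫ _, c * |t| ∂μ := by simp
    _ ≤ _ := integral_mono (integrable_const _) (i1.add i2) fun x => ?_
  have h1 := hf.coercive (dotp β x - t)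
  have hy := hf.nonneg (dotp β x - t)
  have h2 : f (dotp β x - t) ≤ 1 + f (dotp β x - t) ^ p := by
    rcases le_total (f (dotp β x - t)) 1 with hle | hle
    · linarith [Real.rpow_nonneg hy p]
    · linarith [Real.self_le_rpow_of_one_le hle hp]
  have h3 : |t| ≤ |dotp β x - t - m| + |dotp β x| + |m| := by
    have := abs_sub_abs_le_abs_sub t (dotp β x - m)
    have := abs_sub (dotp β x) m
    have e : dotp β x - t - m = -(t - (dotp β x - m)) := by ring
    rw [e, abs_neg]
    linarith
  have h4 := mul_le_mul_of_nonneg_left h3 hc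
  simp only [Pi.add_apply]
  linarith

lemma IsExpandingLoss.exists_lossSlope_nonneg (hf : IsExpandingLoss f s c m K) (hc : 0 < c)
    (h : IsNorm nrm) (hp : 1 ≤ p) {μ : Measure (Vec n)} [IsProbabilityMeasure μ]
    (hμ : MemLp nrm (ENNReal.ofReal p) μ) (β : Vec n) :
    (∃ a, 0 ≤ lossSlope f s c p μ β a) ∧ ∃ b, lossSlope f s c p μ β b ≤ 0 := by
  obtain ⟨A, hA⟩ := hf.exists_linear_growth hc.le h hp hμ β
  set Φ := fun t => ∫ x, f (dotp β x - t) ^ p ∂μ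
  have hsub : ∀ t, Φ t + lossSlope f s c p μ β t * (t - 0) ≤ Φ 0 := fun t =>
    hf.add_lossSlope_mul_le hc.le h hp hμ β t 0
  set T := (|A| + |Φ 0| + 1) / c
  have hT : 0 < T := by positivity
  have hcT : c * T = |A| + |Φ 0| + 1 := mul_div_cancel₀ _ hc.ne'
  have hbig : ∀ t, |t| = T → Φ 0 < Φ t := by
    intro t ht
    have := hA t
    rw [ht, hcT] at this
    change _ ≤ A + Φ t at this
    linarith [le_abs_self A, le_abs_self (Φ 0)]
  constructor
  · refine ⟨-T, ?_⟩
    by_contra! hneg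
    have := hbig (-T) (by rw [abs_neg, abs_of_pos hT])
    have := hsub (-T)
    nlinarith
  · refine ⟨T, ?_⟩
    by_contra! hpos
    have := hbig T (abs_of_pos hT)
    have := hsub T
    nlinarith

/-- A function changing sign between `a` and `b` does so between two nearby points. -/
lemma exists_nearby_sign_change {M : ℝ → ℝ} {a b : ℝ} (ha : 0 ≤ M a) (hb : M b ≤ 0) {N : ℕ}
    (hN : 0 < N) :
    ∃ t₁ t₂, 0 ≤ M t₁ ∧ M t₂ ≤ 0 ∧ |t₂ - t₁| ≤ |b - a| / N ∧ |t₁ - a| ≤ |b - a| := by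
  have hN' : (0 : ℝ) < N := by exact_mod_cast hN
  by_contra! hcon
  have hind : ∀ k : ℕ, k ≤ N → 0 ≤ M (a + k / N * (b - a)) ∧ (0 < k →
      0 < M (a + k / N * (b - a))) := by
    intro k
    induction k with
    | zero => simpa using ha
    | succ k ih =>
      intro hk
      have hkN : (k : ℝ) / N ≤ 1 := by
        rw [div_le_one hN']
        exact_mod_cast (Nat.le_succ k).trans hk
      suffices 0 < M (a + (k + 1 : ℕ) / N * (b - a)) from ⟨this.le, fun _ => this⟩
      by_contra! hle
      have := hcon _ _ (ih (by omega)).1 hle (by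
        have e : a + ((k + 1 : ℕ) : ℝ) / N * (b - a) - (a + k / N * (b - a)) = (b - a) / N := by
          push_cast
          ring
        rw [e, abs_div, abs_of_pos hN'])
      rw [add_sub_cancel_left, abs_mul, abs_of_nonneg (a := (k : ℝ) / N) (by positivity)] at this
      exact absurd this (not_lt.2 (mul_le_of_le_one_left (abs_nonneg _) hkN))
  have := (hind N le_rfl).2 hN
  rw [div_self hN'.ne', one_mul, add_sub_cancel] at this
  linarith


/-- Moving each point along `v` in proportion to its loss at the centers `t₁` and `t₂`. -/
lemma IsExpandingLoss.exists_expansion (hf : IsExpandingLoss f s c m K) (hc : 0 ≤ c)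
    (h : IsNorm nrm) (hp : 1 ≤ p) {μ : Measure (Vec n)} [IsProbabilityMeasure μ]
    (hμ : MemLp nrm (ENNReal.ofReal p) μ) {ε : ℝ} (hε : 0 ≤ ε) {β v : Vec n} (hv : nrm v ≤ 1)
    (hd : 0 ≤ dotp β v) {r θ t₁ t₂ : ℝ} (hr : 0 ≤ r) (h0 : 0 ≤ θ) (h1 : θ ≤ 1)
    (hθ : θ * lossSlope f s c p μ β t₁ + (1 - θ) * lossSlope f s c p μ β t₂ = 0)
    (hcost : r ^ p * (θ * ∫ x, f (dotp β x - t₁) ^ p ∂μ +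
      (1 - θ) * ∫ x, f (dotp β x - t₂) ^ p ∂μ) ≤ ε ^ p) :
    ∃ F ∈ WballVec nrm (ENNReal.ofReal p) μ ε,
      (1 + c * r * dotp β v) ^ p * (θ * ∫ x, f (dotp β x - t₁) ^ p ∂μ +
          (1 - θ) * ∫ x, f (dotp β x - t₂) ^ p ∂μ) -
        (1 + c * r * dotp β v) ^ (p - 1) * (θ * lossSlope f s c p μ β t₁ * (t₂ - t₁)) ≤
      VInfT (fun z t => f (z - t)) p F β := by
  have hp0 : 0 < p := by linarith
  have hfm := (hf.continuous hc).measurable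
  have hsm := hf.measurable_dir
  have hdm := (continuous_dotp β).measurable
  set T : ℝ → Vec n → Vec n := fun t x =>
    x + (r * (s (dotp β x - t) * f (dotp β x - t))) • v with hT
  have hTm : ∀ t, Measurable (T t) := fun t => by
    have : Measurable fun x => r * (s (dotp β x - t) * f (dotp β x - t)) :=
      ((hsm.comp (hdm.sub_const t)).mul (hfm.comp (hdm.sub_const t))).const_mul r
    exact measurable_id.add (this.smul_const v)
  set Φ : ℝ → ℝ := fun t => ∫ x, f (dotp β x - t) ^ p ∂μ with hΦ
  have hΦ0 : ∀ t, 0 ≤ Φ t := hf.integral_nonneg p μ β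
  have htr : ∀ t, TransportLE nrm p μ (μ.map (T t)) (ENNReal.ofReal (r ^ p * Φ t)) := by
    intro t
    refine TransportLE.map h (hTm t) ?_
    rw [hΦ, ← integral_const_mul, ofReal_integral_eq_lintegral_ofReal
      ((hf.integrable hc h hp hμ β t).const_mul _)
      (.of_forall fun x => mul_nonneg (by positivity) (Real.rpow_nonneg (hf.nonneg _) _))]
    refine lintegral_mono fun x => ?_
    have hy := hf.nonneg (dotp β x - t)
    rw [← Real.mul_rpow hr hy, ← ENNReal.ofReal_rpow_of_nonneg (mul_nonneg hr hy) hp0.le]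
    refine ENNReal.rpow_le_rpow (ENNReal.ofReal_le_ofReal ?_) hp0.le
    rw [hT, add_sub_cancel_left, h.2.1, abs_mul, abs_mul, abs_of_nonneg hr, abs_of_nonneg hy]
    have hs := hf.abs_dir_le (dotp β x - t)
    calc r * (|s (dotp β x - t)| * f (dotp β x - t)) * nrm v
        ≤ r * (|s (dotp β x - t)| * f (dotp β x - t)) * 1 := by gcongr
      _ ≤ r * (1 * f (dotp β x - t)) * 1 := by gcongr
      _ = r * f (dotp β x - t) := by ring
  have hF := (htr t₁).mixture h0 h1 (htr t₂)
  have hF' : TransportLE nrm p μ (mixture θ (μ.map (T t₁)) (μ.map (T t₂)))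
      (ENNReal.ofReal ε ^ p) := by
    refine ⟨hF.1, ?_⟩
    obtain ⟨π, hπ, hle⟩ := hF.2
    refine ⟨π, hπ, hle.trans ?_⟩
    have h1' : 0 ≤ 1 - θ := by linarith
    rw [← ENNReal.ofReal_mul h0, ← ENNReal.ofReal_mul h1',
      ← ENNReal.ofReal_add (mul_nonneg h0 (mul_nonneg (by positivity) (hΦ0 _)))
        (mul_nonneg h1' (mul_nonneg (by positivity) (hΦ0 _))),
      ENNReal.ofReal_rpow_of_nonneg hε hp0.le]
    refine ENNReal.ofReal_le_ofReal (le_trans (le_of_eq ?_) hcost)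
    ring
  refine ⟨_, hF'.mem_wballVec h hp hμ, le_vInfT fun τ => ?_⟩
  set κ := 1 + c * r * dotp β v with hκ
  have hκ0 : 0 ≤ κ := by positivity
  have hi : ∀ t, Integrable (fun x => f (dotp β x - τ) ^ p) (μ.map (T t)) := fun t => by
    have := (htr t).1
    exact hf.integrable hc h hp ((htr t).memLp h hp ENNReal.ofReal_ne_top hμ) β τ
  have key : ∀ t, κ ^ p * Φ t + κ ^ (p - 1) * (lossSlope f s c p μ β t * (t - τ)) ≤
      ∫ x, f (dotp β x - τ) ^ p ∂(μ.map (T t)) := by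
    intro t
    have hm := measurable_loss_rpow hf hc p β τ
    rw [integral_map (hTm t).aemeasurable hm.aestronglyMeasurable]
    have j : Integrable (fun x => f (dotp β (T t x) - τ) ^ p) μ :=
      (integrable_map_measure hm.aestronglyMeasurable (hTm t).aemeasurable).1 (hi t)
    have i1 := (hf.integrable hc h hp hμ β t).const_mul (κ ^ p)
    have i2 := ((hf.integrable_slope hc h hp hμ β t).mul_const (t - τ)).const_mul (κ ^ (p - 1))
    rw [hΦ, lossSlope, ← integral_mul_const, ← integral_const_mul, ← integral_const_mul,
      ← integral_add i1 i2]
    refine integral_mono (i1.add i2) j fun x => ?_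
    have hy := hf.nonneg (dotp β x - t)
    have hrd : 0 ≤ r * dotp β v := by positivity
    have e : dotp β (T t x) = (dotp β x - t +
        (r * dotp β v) * s (dotp β x - t) * f (dotp β x - t)) + t := by
      rw [hT, dotp_add, dotp_smul]
      ring
    have hsub := hf.rpow_subgradient hp (dotp β (T t x) - t) (dotp β (T t x) - τ)
    have e1 : f (dotp β (T t x) - t) = κ * f (dotp β x - t) := by
      rw [e, add_sub_cancel_right, hf.expand _ _ hrd, hκ, mul_assoc c]
    have e2 : s (dotp β (T t x) - t) = s (dotp β x - t) := by
      rw [e, add_sub_cancel_right, hf.dir_expand _ _ hrd]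
    rw [e1, e2, sub_sub_sub_cancel_left, Real.mul_rpow hκ0 hy, Real.mul_rpow hκ0 hy] at hsub
    beta_reduce
    linarith
  rw [integral_mixture h0 h1 (hi t₁) (hi t₂)]
  have k1 := mul_le_mul_of_nonneg_left (key t₁) h0
  have k2 := mul_le_mul_of_nonneg_left (key t₂) (sub_nonneg.2 h1)
  have hz : κ ^ (p - 1) * (t₂ - τ) * (θ * lossSlope f s c p μ β t₁ +
    (1 - θ) * lossSlope f s c p μ β t₂) = 0 := by rw [hθ, mul_zero]
  linarith

/-- The regularized value is approached within the Wasserstein ball. -/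
lemma IsExpandingLoss.exists_mem_wballVec_lt (hf : IsExpandingLoss f s c m K) (hc : 0 < c)
    (h : IsNorm nrm) (hp : 1 ≤ p) {μ : Measure (Vec n)} [IsProbabilityMeasure μ]
    (hμ : MemLp nrm (ENNReal.ofReal p) μ) {ε : ℝ} (hε : 0 ≤ ε) (β : Vec n) {η : ℝ}
    (hη : 0 < η) :
    ∃ F ∈ WballVec nrm (ENNReal.ofReal p) μ ε,
      (VInfT (fun z t => f (z - t)) p μ β ^ (1 / p) + c * ε * dualNorm nrm β) ^ p - η ≤
        VInfT (fun z t => f (z - t)) p F β := by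
  have hp0 : 0 < p := by linarith
  obtain ⟨v, hv, hvd, hd, -⟩ := exists_dotp_eq_dualNorm h β
  rw [← hvd] at hd ⊢
  have hV0 := hf.vInfT_nonneg p μ β
  have hVle := hf.vInfT_le p μ β
  set V := VInfT (fun z t => f (z - t)) p μ β
  rcases hV0.eq_or_lt with hV | hV
  · rw [← hV, Real.zero_rpow (by positivity), zero_add]
    rcases hd.eq_or_lt with hd | hd
    · have hid := TransportLE.map h (T := id) (μ := μ) (p := p) (a := ENNReal.ofReal ε ^ p)
        measurable_id (by simp [h.map_zero, hp0])
      rw [Measure.map_id] at hid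
      refine ⟨μ, hid.mem_wballVec h hp hμ, ?_⟩
      rw [← hd, mul_zero, Real.zero_rpow hp0.ne']
      linarith [hf.vInfT_nonneg p μ β]
    have hlim : Filter.Tendsto (fun R : ℝ => dotp β v - K / R) Filter.atTop
        (nhds (dotp β v)) := by
      simpa using tendsto_const_nhds.sub (tendsto_const_nhds.div_atTop (a := K) Filter.tendsto_id)
    have hlim' : Filter.Tendsto (fun R : ℝ => (c * ε * (dotp β v - K / R)) ^ p) Filter.atTop
        (nhds ((c * ε * dotp β v) ^ p)) :=
      (hlim.const_mul (c * ε)).rpow_const (Or.inr hp0.le)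
    obtain ⟨R, ⟨⟨hR0, hRε⟩, hRd⟩, hRη⟩ := (((Filter.eventually_gt_atTop (0 : ℝ)).and
      (Filter.eventually_ge_atTop ε)).and (hlim.eventually_const_lt hd)).and
        (hlim'.eventually_const_lt (sub_lt_self _ hη)) |>.exists
    obtain ⟨F, hF, hle⟩ := hf.exists_symmetric_spread hc.le h hp hμ hε hv hR0 hRε hRd.le
    exact ⟨F, hF, hRη.le.trans hle⟩
  · obtain ⟨⟨a, ha⟩, b, hb⟩ := hf.exists_lossSlope_nonneg hc h hp hμ β
    set Φ : ℝ → ℝ := fun t => ∫ x, f (dotp β x - t) ^ p ∂μ with hΦ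
    set M := lossSlope f s c p μ β
    have hiB : Integrable (fun x => (f (dotp β x - a) + c * (|b - a| + 1)) ^ p) μ := by
      have hC : 0 ≤ c * (|b - a| + 1) := by positivity
      have := ((hf.memLp hc.le h hμ β a).add
        (memLp_const (c * (|b - a| + 1)))).integrable_norm_rpow (by simpa using hp0)
          ENNReal.ofReal_ne_top
      simpa only [Pi.add_apply, Real.norm_of_nonneg (add_nonneg (hf.nonneg _) hC),
        ENNReal.toReal_ofReal hp0.le] using this
    set B := ∫ x, (f (dotp β x - a) + c * (|b - a| + 1)) ^ p ∂μ
    have hMB : ∀ t, |t - a| ≤ |b - a| → M t ≤ B := by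
      intro t ht
      have h1 := hf.add_lossSlope_mul_le hc.le h hp hμ β t (t - 1)
      have h2 : ∫ x, f (dotp β x - (t - 1)) ^ p ∂μ ≤ B := by
        refine integral_mono (hf.integrable hc.le h hp hμ β (t - 1)) hiB fun x =>
          Real.rpow_le_rpow (hf.nonneg _) ?_ hp0.le
        refine (hf.lipschitz _ (dotp β x - a)).trans ?_
        have e : dotp β x - (t - 1) - (dotp β x - a) = -(t - a) + 1 := by ring
        rw [e]
        have := abs_add_le (-(t - a)) 1
        rw [abs_neg, abs_one] at this
        gcongr
        linarith
      have h3 := hf.integral_nonneg p μ β t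
      linarith
    have hB0 : 0 ≤ B := ha.trans (hMB a (by simp))
    set E := (1 + c * (ε / V ^ (1 / p)) * dotp β v) ^ (p - 1) * (B * |b - a|)
    have hE0 : 0 ≤ E := by positivity
    obtain ⟨N, hN⟩ := exists_nat_gt (E / η)
    have hNr : (0 : ℝ) < N := lt_of_le_of_lt (by positivity) hN
    obtain ⟨t₁, t₂, hM1, hM2, ht, hta⟩ :=
      exists_nearby_sign_change (M := M) ha hb (by exact_mod_cast hNr : 0 < N)
    obtain ⟨θ, h0, h1, hθ⟩ : ∃ θ, 0 ≤ θ ∧ θ ≤ 1 ∧ θ * M t₁ + (1 - θ) * M t₂ = 0 := by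
      rcases (hM2.trans hM1).eq_or_lt with heq | hlt
      · exact ⟨0, le_rfl, zero_le_one, by linarith⟩
      · refine ⟨-M t₂ / (M t₁ - M t₂), div_nonneg (by linarith) (by linarith),
          (div_le_one (by linarith)).2 (by linarith), ?_⟩
        have : M t₁ - M t₂ ≠ 0 := by linarith
        field_simp
        ring
    set W := θ * Φ t₁ + (1 - θ) * Φ t₂
    have hVW : V ≤ W := by
      have := mul_le_mul_of_nonneg_left (hVle t₁) h0
      have := mul_le_mul_of_nonneg_left (hVle t₂) (sub_nonneg.2 h1)
      linarith
    have hW : 0 < W := hV.trans_le hVW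
    have hWp : 0 < W ^ (1 / p) := by positivity
    have hWpp : (W ^ (1 / p)) ^ p = W := by
      rw [← Real.rpow_mul hW.le, one_div_mul_cancel hp0.ne', Real.rpow_one]
    have hVp : V ^ (1 / p) ≤ W ^ (1 / p) := Real.rpow_le_rpow hV0 hVW (by positivity)
    have hVpos : 0 < V ^ (1 / p) := by positivity
    obtain ⟨F, hF, hle⟩ := hf.exists_expansion hc.le h hp hμ hε hv hd
      (r := ε / W ^ (1 / p)) (by positivity) h0 h1 hθ (by
        change _ * W ≤ _
        rw [Real.div_rpow hε hWp.le, hWpp, div_mul_cancel₀ _ hW.ne'])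
    refine ⟨F, hF, le_trans ?_ hle⟩
    change _ ≤ _ * W - _ * (θ * M t₁ * _)
    have hmain : (V ^ (1 / p) + c * ε * dotp β v) ^ p ≤
        (1 + c * (ε / W ^ (1 / p)) * dotp β v) ^ p * W := by
      nth_rewrite 2 [← hWpp]
      rw [← Real.mul_rpow (by positivity) hWp.le]
      refine Real.rpow_le_rpow (by positivity) (le_trans (add_le_add_left hVp _) (le_of_eq ?_))
        hp0.le
      field_simp
    have herr : (1 + c * (ε / W ^ (1 / p)) * dotp β v) ^ (p - 1) *
        (θ * M t₁ * (t₂ - t₁)) ≤ η := by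
      calc (1 + c * (ε / W ^ (1 / p)) * dotp β v) ^ (p - 1) * (θ * M t₁ * (t₂ - t₁))
          ≤ (1 + c * (ε / V ^ (1 / p)) * dotp β v) ^ (p - 1) * (1 * B * (|b - a| / N)) := by
            have hstep : θ * M t₁ * (t₂ - t₁) ≤ 1 * B * (|b - a| / N) :=
              (mul_le_mul_of_nonneg_left ((le_abs_self _).trans ht) (mul_nonneg h0 hM1)).trans
                (mul_le_mul_of_nonneg_right (mul_le_mul h1 (hMB t₁ hta) hM1 zero_le_one)
                  (by positivity))
            refine (mul_le_mul_of_nonneg_left hstep (by positivity)).trans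
              (mul_le_mul_of_nonneg_right (Real.rpow_le_rpow (by positivity) ?_
                (sub_nonneg.2 hp)) (by positivity))
            gcongr
        _ = E / N := by ring
        _ ≤ η := by
            rw [div_le_iff₀ hNr]
            rw [div_lt_iff₀ hη] at hN
            linarith
    linarith

end LowerBound

lemma IsExpandingLoss.sSup_vInfT_eq {n : ℕ} {nrm : Vec n → ℝ} {p : ℝ} {f s : ℝ → ℝ} {c m K : ℝ}
    (hf : IsExpandingLoss f s c m K) (hc : 0 < c)
    (h : IsNorm nrm) (hp : 1 ≤ p) {μ : Measure (Vec n)} [IsProbabilityMeasure μ]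
    (hμ : MemLp nrm (ENNReal.ofReal p) μ) {ε : ℝ} (hε : 0 ≤ ε) (β : Vec n) :
    sSup {a | ∃ F ∈ WballVec nrm (ENNReal.ofReal p) μ ε,
        a = VInfT (fun z t => f (z - t)) p F β} =
      (VInfT (fun z t => f (z - t)) p μ β ^ (1 / p) + c * ε * dualNorm nrm β) ^ p := by
  have hub : ∀ F ∈ WballVec nrm (ENNReal.ofReal p) μ ε, _ := fun F hF =>
    hf.vInfT_le_of_mem_wballVec hc.le h hp hμ hε hF β
  have hlow := fun η (hη : 0 < η) => hf.exists_mem_wballVec_lt hc h hp hμ hε β hη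
  obtain ⟨F₁, hF₁, -⟩ := hlow 1 one_pos
  refine le_antisymm (csSup_le ⟨_, F₁, hF₁, rfl⟩ ?_) (le_of_forall_pos_le_add fun η hη => ?_)
  · rintro _ ⟨F, hF, rfl⟩
    exact hub F hF
  · obtain ⟨F, hF, hle⟩ := hlow η hη
    rw [← sub_le_iff_le_add]
    refine hle.trans (le_csSup
      ⟨(VInfT (fun z t => f (z - t)) p μ β ^ (1 / p) + c * ε * dualNorm nrm β) ^ p, ?_⟩
      ⟨F, hF, rfl⟩)
    rintro _ ⟨G, hG, rfl⟩
    exact hub G hG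

/-- Corollary 2 of the paper: exact regularization for functionals of the
form `𝒱^F(Z) = inf_t E^F[ℓ(Z,t)^p]` with `ℓ(z,t) = c·ℓ̄(z-t)` for `ℓ̄ = ℓ₃` or `ℓ₄`. -/
theorem stmt15 {n : ℕ} (nrm : Vec n → ℝ) (hnrm : IsNorm nrm)
    (p : ℝ) (hp : 1 ≤ p) (c : ℝ) (hc : 1 ≤ c)
    (ℓ : ℝ → ℝ → ℝ)
    (hℓ : ∃ ℓ' : ℝ → ℝ,
        ((∃ m₁ m₂ : ℝ, 0 ≤ m₂ ∧ ℓ' = fun x => max (|x - m₁| - m₂) 0) ∨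
         (∃ m b : ℝ, 0 < b ∧ ℓ' = fun x => |x - m| + b)) ∧
        ℓ = fun z t => c * ℓ' (z - t))
    (F₀ : Measure (Vec n)) (hF₀ : IsProbabilityMeasure F₀)
    (hmom : HasMomentP nrm (ENNReal.ofReal p) F₀)
    (ε : ℝ) (hε : 0 ≤ ε) (D : Set (Vec n)) :
    sInf {r | ∃ β ∈ D, r =
        sSup {s | ∃ F ∈ WballVec nrm (ENNReal.ofReal p) F₀ ε, s = VInfT ℓ p F β}}
      = sInf {r | ∃ β ∈ D, r =
          ((VInfT ℓ p F₀ β) ^ (1 / p) + c * ε * dualNorm nrm β) ^ p} := by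
  rw [hasMomentP_iff_memLp hnrm hp] at hmom
  obtain ⟨s, m, K, hf, hℓ⟩ : ∃ s m K, ∃ f : ℝ → ℝ, IsExpandingLoss f s c m K ∧
      ℓ = fun z t => f (z - t) := by
    obtain ⟨ℓ', ⟨m₁, m₂, hm₂, rfl⟩ | ⟨m, b, hb, rfl⟩, rfl⟩ := hℓ
    · exact ⟨_, m₁, m₂, _, isExpandingLoss_deadZone (by linarith) m₁ hm₂, rfl⟩
    · exact ⟨_, m, 0, _, isExpandingLoss_abs_add (by linarith) m hb, rfl⟩
  obtain ⟨hf, rfl⟩ := hℓ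
  simp only [hf.sSup_vInfT_eq (by linarith) hnrm hp hmom hε]
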